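/- arXiv:2402.05330 — 3 statements merged into one kernel-verified Lean document; each statement's English description precedes it below -/
import Mathlib

section
/- Fix a class y and let (μ_ν)_{ν ∈ N} be a family of probability measures on a measurable space 𝒳, indexed by a nuisance parameter ν in a nonempty set N (μ_ν is the conditional law of the data X given class y and nuisance ν). Let λ : 𝒳 → ℝ be measurable. Fix α ∈ [0,1] and γ ∈ [0,α], and set β = α − γ. Suppose c : N → ℝ is a family of cutoffs satisfying μ_ν {x : λ x ≤ c ν} ≤ β for every ν ∈ N, and S : 𝒳 → Set N is a (1−γ)-confidence set for ν, i.e. μ_ν {x : ν ∈ S x} ≥ 1 − γ for every ν ∈ N, with each S x nonempty. Define the nuisance-aware data-dependent cutoff C*(x) = inf {c ν : ν ∈ S x} (assume c is bounded below so the infimum is a real number), and assume the sets {x : λ x ≤ C*(x)} and {x : ν ∈ S x} are measurable. Then the type-I error (false positive rate) is controlled at level α uniformly over the nuisance parameter: for every ν ∈ N, μ_ν {x : λ x ≤ C*(x)} ≤ α. -/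
open MeasureTheory Set

/-- **Nuisance-aware data-dependent cutoffs control the false positive rate (type-I error).**
If `c ν` is a `β = α - γ` level rejection cutoff for each nuisance value `ν`, and
`S x` is a `(1-γ)` confidence set for the nuisance parameter, then the data-dependent
cutoff `C*(x) = inf {c ν : ν ∈ S x}` controls the type-I error at level `α`
uniformly over the nuisance parameter space. -/
theorem naps_cutoff_fpr_control
    {𝒳 N : Type*} [MeasurableSpace 𝒳] [Nonempty N]
    (μ : N → Measure 𝒳) (hμ : ∀ ν, IsProbabilityMeasure (μ ν))
    (lam : 𝒳 → ℝ) (hlam : Measurable lam)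
    (α γ : ℝ) (hα : α ∈ Icc (0 : ℝ) 1) (hγ : γ ∈ Icc (0 : ℝ) α)
    (c : N → ℝ) (hc_bdd : BddBelow (Set.range c))
    (hc : ∀ ν : N, μ ν {x | lam x ≤ c ν} ≤ ENNReal.ofReal (α - γ))
    (S : 𝒳 → Set N) (hS_ne : ∀ x, (S x).Nonempty)
    (hS : ∀ ν : N, ENNReal.ofReal (1 - γ) ≤ μ ν {x | ν ∈ S x})
    (Cstar : 𝒳 → ℝ) (hCstar : ∀ x, Cstar x = sInf (c '' S x))
    (hmeas_rej : MeasurableSet {x | lam x ≤ Cstar x})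
    (hmeas_S : ∀ ν : N, MeasurableSet {x | ν ∈ S x}) :
    ∀ ν : N, μ ν {x | lam x ≤ Cstar x} ≤ ENNReal.ofReal α := by
  intro ν
  have := hμ ν
  have h1 : μ ν {x | ν ∈ S x}ᶜ ≤ ENNReal.ofReal γ := by
    rw [prob_compl_eq_one_sub (hmeas_S ν)]
    calc 1 - μ ν {x | ν ∈ S x} ≤ 1 - ENNReal.ofReal (1 - γ) := tsub_le_tsub_left (hS ν) 1
      _ = ENNReal.ofReal γ := by
        rw [← ENNReal.ofReal_one, ← ENNReal.ofReal_sub _ (by linarith [hγ.2, hα.2])]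
        congr 1
        ring
  have hsub : {x | lam x ≤ Cstar x} ⊆ {x | lam x ≤ c ν} ∪ {x | ν ∈ S x}ᶜ := by
    intro x hx
    by_cases h : ν ∈ S x
    · left
      have h2 : Cstar x ≤ c ν := by
        rw [hCstar]
        exact csInf_le (hc_bdd.mono (image_subset_range _ _)) (mem_image_of_mem c h)
      exact le_trans hx h2
    · right
      exact h
  calc μ ν {x | lam x ≤ Cstar x} ≤ μ ν ({x | lam x ≤ c ν} ∪ {x | ν ∈ S x}ᶜ) := measure_mono hsub
    _ ≤ μ ν {x | lam x ≤ c ν} + μ ν {x | ν ∈ S x}ᶜ := measure_union_le _ _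
    _ ≤ ENNReal.ofReal (α - γ) + ENNReal.ofReal γ := add_le_add (hc ν) h1
    _ = ENNReal.ofReal α := by
      rw [← ENNReal.ofReal_add (by linarith [hγ.2]) hγ.1]
      congr 1
      ring
end

section
/- Fix a class y and let (μ_ν)_{ν ∈ N} be a family of probability measures on a measurable space 𝒳, indexed by a nuisance parameter ν in a nonempty set N (μ_ν is the conditional law of the data X given class 1−y and nuisance ν). Let λ : 𝒳 → ℝ be measurable. Fix α ∈ [0,1] and γ ∈ [0, 1−α], and set β = α + γ. Suppose c̃ : N → ℝ is a family of cutoffs satisfying μ_ν {x : λ x ≤ c̃ ν} ≥ β for every ν ∈ N, and S : 𝒳 → Set N is a (1−γ)-confidence set for ν, i.e. μ_ν {x : ν ∈ S x} ≥ 1 − γ for every ν ∈ N, with each S x nonempty. Define the data-dependent cutoff C̃*(x) = sup {c̃ ν : ν ∈ S x} (assume c̃ is bounded above so the supremum is a real number), and assume the sets {x : λ x ≤ C̃*(x)} and {x : ν ∈ S x} are measurable. Then the true positive rate (recall) is at least α uniformly over the nuisance parameter: for every ν ∈ N, μ_ν {x : λ x ≤ C̃*(x)} ≥ α. -/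
open MeasureTheory Set

/-- **Nuisance-aware data-dependent cutoffs guarantee a minimum recall (TPR control).**
If `c̃ ν` achieves rejection probability at least `β = α + γ` under the alternative class
for each nuisance value `ν`, and `S x` is a `(1-γ)` confidence set for the nuisance
parameter, then the data-dependent cutoff `C̃*(x) = sup {c̃ ν : ν ∈ S x}` guarantees a
true positive rate of at least `α` uniformly over the nuisance parameter space. -/
theorem naps_cutoff_tpr_control
    {𝒳 N : Type*} [MeasurableSpace 𝒳] [Nonempty N]
    (μ : N → Measure 𝒳) (hμ : ∀ ν, IsProbabilityMeasure (μ ν))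
    (lam : 𝒳 → ℝ) (hlam : Measurable lam)
    (α γ : ℝ) (hα : α ∈ Icc (0 : ℝ) 1) (hγ : γ ∈ Icc (0 : ℝ) (1 - α))
    (ctil : N → ℝ) (hc_bdd : BddAbove (Set.range ctil))
    (hc : ∀ ν : N, ENNReal.ofReal (α + γ) ≤ μ ν {x | lam x ≤ ctil ν})
    (S : 𝒳 → Set N) (hS_ne : ∀ x, (S x).Nonempty)
    (hS : ∀ ν : N, ENNReal.ofReal (1 - γ) ≤ μ ν {x | ν ∈ S x})
    (Ctil : 𝒳 → ℝ) (hCtil : ∀ x, Ctil x = sSup (ctil '' S x))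
    (hmeas_rej : MeasurableSet {x | lam x ≤ Ctil x})
    (hmeas_S : ∀ ν : N, MeasurableSet {x | ν ∈ S x}) :
    ∀ ν : N, ENNReal.ofReal α ≤ μ ν {x | lam x ≤ Ctil x} := by
  intro ν
  haveI := hμ ν
  have hsub : {x | lam x ≤ ctil ν} ⊆ {x | lam x ≤ Ctil x} ∪ {x | ν ∈ S x}ᶜ := by
    intro x hx
    by_cases h : ν ∈ S x
    · left
      have h1 : ctil ν ≤ Ctil x := by
        rw [hCtil x]
        exact le_csSup (hc_bdd.mono (image_subset_range _ _)) (mem_image_of_mem _ h)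
      exact le_trans hx h1
    · right
      exact h
  have h1 : (μ ν).real {x | lam x ≤ ctil ν} ≤
      (μ ν).real {x | lam x ≤ Ctil x} + (μ ν).real {x | ν ∈ S x}ᶜ :=
    (measureReal_mono hsub).trans (measureReal_union_le _ _)
  have h2 : (μ ν).real {x | ν ∈ S x}ᶜ = 1 - (μ ν).real {x | ν ∈ S x} :=
    probReal_compl_eq_one_sub (hmeas_S ν)
  have h3 : α + γ ≤ (μ ν).real {x | lam x ≤ ctil ν} :=
    (ENNReal.ofReal_le_iff_le_toReal (measure_ne_top _ _)).1 (hc ν)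
  have h4 : 1 - γ ≤ (μ ν).real {x | ν ∈ S x} :=
    (ENNReal.ofReal_le_iff_le_toReal (measure_ne_top _ _)).1 (hS ν)
  have h5 : α ≤ (μ ν).real {x | lam x ≤ Ctil x} := by linarith
  exact (ENNReal.ofReal_le_iff_le_toReal (measure_ne_top _ _)).2 h5
end

section
/- Let N be a nonempty set of nuisance parameters, 𝒳 a measurable space, and for each label y ∈ {0,1} and ν ∈ N let κ(y,ν) be a probability measure on 𝒳 (the conditional law of the data X given (y, ν)). Fix α ∈ [0,1] and γ ∈ [0,α], and set β = α − γ. For each y ∈ {0,1}, let τ_y : 𝒳 → ℝ be a measurable test statistic, let c_y : N → ℝ be bounded below and satisfy κ(y,ν) {x : τ_y x ≤ c_y ν} ≤ β for every ν ∈ N, and let S_y : 𝒳 → Set N have nonempty values and satisfy κ(y,ν) {x : ν ∈ S_y x} ≥ 1 − γ for every ν ∈ N. Define C*_y(x) = inf {c_y ν : ν ∈ S_y x} and the nuisance-aware prediction set H(x) = {y ∈ {0,1} : τ_y x > C*_y(x)}; assume the sets {x : τ_y x ≤ C*_y(x)} and {x : ν ∈ S_y x} are measurable for each y, ν. Then H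 is conditionally valid across the entire parameter space: for every y ∈ {0,1} and every ν ∈ N, κ(y,ν) {x : y ∈ H x} ≥ 1 − α. -/
open MeasureTheory Set

/-- **Conditional validity of nuisance-aware prediction sets (NAPS).**
For each label `y ∈ {0,1}` let `τ_y` be a test statistic, `c_y ν` a `β = α - γ` level
rejection cutoff at nuisance value `ν`, and `S_y x` a `(1-γ)` confidence set for the
nuisance parameter. The nuisance-aware prediction set
`H(x) = {y | τ_y x > C*_y(x)}` with `C*_y(x) = inf {c_y ν : ν ∈ S_y x}` covers the
true label with probability at least `1 - α`, conditionally on every `(y, ν)`. -/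
theorem naps_conditional_coverage
    {𝒳 N : Type*} [MeasurableSpace 𝒳] [Nonempty N]
    (κ : Fin 2 → N → Measure 𝒳) (hκ : ∀ y ν, IsProbabilityMeasure (κ y ν))
    (α γ : ℝ) (hα : α ∈ Icc (0 : ℝ) 1) (hγ : γ ∈ Icc (0 : ℝ) α)
    (τ : Fin 2 → 𝒳 → ℝ) (hτ : ∀ y, Measurable (τ y))
    (c : Fin 2 → N → ℝ) (hc_bdd : ∀ y, BddBelow (Set.range (c y)))
    (hc : ∀ y ν, κ y ν {x | τ y x ≤ c y ν} ≤ ENNReal.ofReal (α - γ))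
    (S : Fin 2 → 𝒳 → Set N) (hS_ne : ∀ y x, (S y x).Nonempty)
    (hS : ∀ y ν, ENNReal.ofReal (1 - γ) ≤ κ y ν {x | ν ∈ S y x})
    (Cstar : Fin 2 → 𝒳 → ℝ) (hCstar : ∀ y x, Cstar y x = sInf (c y '' S y x))
    (H : 𝒳 → Set (Fin 2)) (hH : ∀ x, H x = {y | Cstar y x < τ y x})
    (hmeas_rej : ∀ y, MeasurableSet {x | τ y x ≤ Cstar y x})
    (hmeas_S : ∀ y ν, MeasurableSet {x | ν ∈ S y x}) :
    ∀ y ν, ENNReal.ofReal (1 - α) ≤ κ y ν {x | y ∈ H x} := by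
  intro y ν
  have hsub : {x | ν ∈ S y x} ⊆ {x | y ∈ H x} ∪ {x | τ y x ≤ c y ν} := by
    intro x hx
    by_cases h : τ y x ≤ c y ν
    · exact Or.inr h
    · left
      have hle : Cstar y x ≤ c y ν := by
        rw [hCstar]
        exact csInf_le ((hc_bdd y).mono (image_subset_range _ _)) (mem_image_of_mem _ hx)
      change y ∈ H x
      rw [hH]
      exact lt_of_le_of_lt hle (not_le.mp h)
  have h1 : ENNReal.ofReal (1 - γ) ≤ κ y ν {x | y ∈ H x} + ENNReal.ofReal (α - γ) :=
    (hS y ν).trans ((measure_mono hsub).trans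
      ((measure_union_le _ _).trans (add_le_add le_rfl (hc y ν))))
  have h2 : (1 - α) = (1 - γ) - (α - γ) := by ring
  rw [h2, ENNReal.ofReal_sub _ (sub_nonneg.mpr hγ.2)]
  exact tsub_le_iff_right.mpr h1
end
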